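/- Optimal outlink structure: assume I and Ī are nonempty, fix E_I, E_in(I), E_Ī, and let F_1, …, F_r be the final classes of the subgraph (I, E_I). Let F be an optimal outlink set, and let v and V = {j ∈ Ī : v_j = max_{k∈Ī} v_k} be computed in the graph E_I ∪ F ∪ E_in(I) ∪ E_Ī. Then every link of F starts in some final class, i.e. F = F^{(1)} ∪ … ∪ F^{(r)} where F^{(s)} = {(i,j) ∈ F : i ∈ F_s}; for every s = 1,…,r one has F^{(s)} ⊆ {(i,j) : i attains min_{k ∈ F_s} v_k and j ∈ V}; and for every s such that E_I ∩ (F_s × F_s) ≠ ∅, the set F^{(s)} contains exactly one link. -/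

import Mathlib

open Matrix Finset

/-- Outdegree of node `i` in the edge set `E`. -/
def outdeg {n : ℕ} (E : Finset (Fin n × Fin n)) (i : Fin n) : ℕ :=
  (Finset.univ.filter (fun j => (i, j) ∈ E)).card

/-- The scaled adjacency matrix `P` of the graph: `P i j = 1 / outdeg i` if `(i,j) ∈ E`. -/
noncomputable def Pmat {n : ℕ} (E : Finset (Fin n × Fin n)) : Matrix (Fin n) (Fin n) ℝ :=
  fun i j => if (i, j) ∈ E then ((outdeg E i : ℝ))⁻¹ else 0

/-- Indicator vector of a set of nodes. -/
def ind {n : ℕ} (I : Finset (Fin n)) : Fin n → ℝ :=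
  fun i => if i ∈ I then 1 else 0

/-- `v = (Id - cP)⁻¹ e_I`, the vector of mean numbers of visits to `I` before zapping. -/
noncomputable def vvec {n : ℕ} (c : ℝ) (E : Finset (Fin n × Fin n)) (I : Finset (Fin n)) : Fin n → ℝ :=
  (1 - c • Pmat E)⁻¹ *ᵥ ind I

/-- PageRank vector `πᵀ = (1-c) zᵀ (Id - cP)⁻¹`. -/
noncomputable def pr {n : ℕ} (c : ℝ) (z : Fin n → ℝ) (E : Finset (Fin n × Fin n)) : Fin n → ℝ :=
  (1 - c) • (((1 - c • Pmat E)⁻¹)ᵀ *ᵥ z)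

/-- PageRank of the set `I`: `πᵀ e_I`. -/
noncomputable def prSet {n : ℕ} (c : ℝ) (z : Fin n → ℝ) (E : Finset (Fin n × Fin n))
    (I : Finset (Fin n)) : ℝ :=
  ∑ i ∈ I, pr c z E i

/-- Node `i` has access to (some node of) the set `J`: `i ∈ J` or a directed path from `i`
reaches `J`. -/
def access {n : ℕ} (E : Finset (Fin n × Fin n)) (i : Fin n) (J : Finset (Fin n)) : Prop :=
  ∃ j ∈ J, Relation.ReflTransGen (fun a b => (a, b) ∈ E) i j

/-- A graph is admissible for `I` (Assumption A + well-definedness): every node has at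
least one outlink and every node of `I` has access to the complement of `I`. -/
def admissible {n : ℕ} (E : Finset (Fin n × Fin n)) (I : Finset (Fin n)) : Prop :=
  (∀ i, 0 < outdeg E i) ∧ ∀ i ∈ I, access E i Iᶜ

/-- `Fs` is a final class of the subgraph `(I, EI)`: it is a nonempty subset of `I`,
strongly connected within itself via links of `EI`, and no link of `EI` leaves it. -/
def FinalClass {n : ℕ} (EI : Finset (Fin n × Fin n)) (I Fs : Finset (Fin n)) : Prop :=
  Fs.Nonempty ∧ Fs ⊆ I ∧
  (∀ i ∈ Fs, ∀ j ∈ Fs,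
    Relation.ReflTransGen (fun a b => (a, b) ∈ EI ∧ a ∈ Fs ∧ b ∈ Fs) i j) ∧
  (∀ p ∈ EI, p.1 ∈ Fs → p.2 ∈ Fs)

/-- Out-neighbours. -/
def nb {n : ℕ} (E : Finset (Fin n × Fin n)) (i : Fin n) : Finset (Fin n) :=
  Finset.univ.filter (fun j => (i, j) ∈ E)

lemma mem_nb {n : ℕ} (E : Finset (Fin n × Fin n)) (i j : Fin n) : j ∈ nb E i ↔ (i, j) ∈ E := by
  simp [nb]

lemma Pmat_mulVec {n : ℕ} (E : Finset (Fin n × Fin n)) (x : Fin n → ℝ) (i : Fin n) :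
    (Pmat E *ᵥ x) i = ((nb E i).card : ℝ)⁻¹ * ∑ j ∈ nb E i, x j := by
  simp only [Matrix.mulVec, dotProduct, Pmat, nb, outdeg, ite_mul, zero_mul]
  rw [← Finset.sum_filter, Finset.mul_sum]

lemma Pmat_mulVec' {n : ℕ} (E : Finset (Fin n × Fin n)) (hE : ∀ i, 0 < outdeg E i)
    (x : Fin n → ℝ) (i : Fin n) :
    (Pmat E *ᵥ x) i * ((nb E i).card : ℝ) = ∑ j ∈ nb E i, x j := by
  rw [Pmat_mulVec]
  have h : ((nb E i).card : ℝ) ≠ 0 := by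
    have := hE i
    have h2 : 0 < (nb E i).card := this
    exact_mod_cast h2.ne'
  field_simp

/-- Maximum principle. -/
lemma max_principle {n : ℕ} (c : ℝ) (hc0 : 0 < c) (hc1 : c < 1)
    (E : Finset (Fin n × Fin n)) (hE : ∀ i, 0 < outdeg E i) (x : Fin n → ℝ)
    (hx : ∀ i, c * (Pmat E *ᵥ x) i ≤ x i) : ∀ i, 0 ≤ x i := by
  intro i0
  obtain ⟨i, -, hi⟩ := Finset.exists_min_image (Finset.univ : Finset (Fin n)) x ⟨i0, Finset.mem_univ _⟩
  refine le_trans ?_ (hi i0 (Finset.mem_univ _))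
  have h1 := hx i
  have h2 : x i ≤ (Pmat E *ᵥ x) i := by
    have hp : (0 : ℝ) < ((nb E i).card : ℝ) := by
      have h2 : 0 < (nb E i).card := hE i
      exact_mod_cast h2
    have h3 := Pmat_mulVec' E hE x i
    have h4 : ((nb E i).card : ℝ) * x i ≤ ∑ j ∈ nb E i, x j := by
      have := Finset.card_nsmul_le_sum (nb E i) x (x i) (fun j _ => hi j (Finset.mem_univ _))
      simpa using this
    by_contra hcon
    push Not at hcon
    nlinarith
  nlinarith

lemma isUnit_mat {n : ℕ} (c : ℝ) (hc0 : 0 < c) (hc1 : c < 1)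
    (E : Finset (Fin n × Fin n)) (hE : ∀ i, 0 < outdeg E i) :
    IsUnit (1 - c • Pmat E) := by
  rw [← Matrix.mulVec_injective_iff_isUnit]
  intro x y hxy
  have key : ∀ a b : Fin n → ℝ, (1 - c • Pmat E) *ᵥ a = (1 - c • Pmat E) *ᵥ b →
      ∀ i, 0 ≤ (a - b) i := by
    intro a b hab
    apply max_principle c hc0 hc1 E hE
    intro i
    have h : (1 - c • Pmat E) *ᵥ (a - b) = 0 := by rw [Matrix.mulVec_sub, hab, sub_self]
    have h2 := congrFun h i
    simp only [Matrix.sub_mulVec, Matrix.one_mulVec, Matrix.smul_mulVec, Pi.sub_apply, Pi.smul_apply,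
      smul_eq_mul, Pi.zero_apply] at h2
    simp only [Pi.sub_apply]
    linarith
  funext i
  have h1 := key x y hxy i
  have h2 := key y x hxy.symm i
  simp only [Pi.sub_apply] at h1 h2
  linarith

lemma vvec_eq {n : ℕ} (c : ℝ) (hc0 : 0 < c) (hc1 : c < 1)
    (E : Finset (Fin n × Fin n)) (hE : ∀ i, 0 < outdeg E i) (I : Finset (Fin n)) (i : Fin n) :
    vvec c E I i = ind I i + c * (Pmat E *ᵥ vvec c E I) i := by
  have hu := isUnit_mat c hc0 hc1 E hE
  have h : (1 - c • Pmat E) *ᵥ vvec c E I = ind I := by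
    unfold vvec
    rw [Matrix.mulVec_mulVec, Matrix.mul_nonsing_inv _ ((Matrix.isUnit_iff_isUnit_det _).mp hu),
      Matrix.one_mulVec]
  have h2 := congrFun h i
  simp only [Matrix.sub_mulVec, Matrix.one_mulVec, Matrix.smul_mulVec, Pi.sub_apply, Pi.smul_apply,
    smul_eq_mul] at h2
  linarith

lemma prSet_eq {n : ℕ} (c : ℝ) (z : Fin n → ℝ) (E : Finset (Fin n × Fin n)) (I : Finset (Fin n)) :
    prSet c z E I = (1 - c) * ∑ i, z i * vvec c E I i := by
  have h1 : prSet c z E I = pr c z E ⬝ᵥ ind I := by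
    simp [prSet, ind, dotProduct]
  have h2 : ∑ i, z i * vvec c E I i = z ⬝ᵥ vvec c E I := rfl
  rw [h1, h2, pr, vvec, smul_dotProduct, Matrix.mulVec_transpose, Matrix.dotProduct_mulVec, smul_eq_mul]

/-- Comparison of two graphs. -/
lemma compare_pr {n : ℕ} (c : ℝ) (hc0 : 0 < c) (hc1 : c < 1) (z : Fin n → ℝ) (hz : ∀ i, 0 < z i)
    (E E' : Finset (Fin n × Fin n)) (hE : ∀ i, 0 < outdeg E i) (hE' : ∀ i, 0 < outdeg E' i)
    (I : Finset (Fin n))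
    (hle : ∀ i, (Pmat E *ᵥ vvec c E I) i ≤ (Pmat E' *ᵥ vvec c E I) i)
    (hpr : prSet c z E' I ≤ prSet c z E I) :
    ∀ i, (Pmat E' *ᵥ vvec c E I) i ≤ (Pmat E *ᵥ vvec c E I) i := by
  set v := vvec c E I with hv
  set v' := vvec c E' I with hv'
  have e1 : ∀ i, v i = ind I i + c * (Pmat E *ᵥ v) i := vvec_eq c hc0 hc1 E hE I
  have e2 : ∀ i, v' i = ind I i + c * (Pmat E' *ᵥ v') i := vvec_eq c hc0 hc1 E' hE' I
  have e3 : ∀ i, (Pmat E' *ᵥ (v' - v)) i = (Pmat E' *ᵥ v') i - (Pmat E' *ᵥ v) i := by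
    intro i; rw [Matrix.mulVec_sub]; rfl
  have hx : ∀ i, 0 ≤ (v' - v) i := by
    apply max_principle c hc0 hc1 E' hE'
    intro i
    rw [e3, Pi.sub_apply, e1 i, e2 i]
    nlinarith [hle i]
  have hP : ∀ i, 0 ≤ (Pmat E' *ᵥ (v' - v)) i := by
    intro i
    rw [Pmat_mulVec]
    exact mul_nonneg (by positivity) (Finset.sum_nonneg (fun j _ => hx j))
  rw [prSet_eq, prSet_eq] at hpr
  have hs : ∑ i, z i * v' i ≤ ∑ i, z i * v i := le_of_mul_le_mul_left hpr (by linarith)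
  by_contra hcon
  push Not at hcon
  obtain ⟨i, hi⟩ := hcon
  have : ∑ i, z i * v i < ∑ i, z i * v' i := by
    apply Finset.sum_lt_sum
    · intro j _
      have := hx j
      simp only [Pi.sub_apply] at this
      exact mul_le_mul_of_nonneg_left (by linarith) (hz j).le
    · refine ⟨i, Finset.mem_univ _, ?_⟩
      apply mul_lt_mul_of_pos_left _ (hz i)
      have h1 := hP i
      rw [e3] at h1
      rw [e1 i, e2 i]
      nlinarith
  linarith

lemma rtg_mono {α : Type*} {r q : α → α → Prop} (h : ∀ a b, r a b → q a b) {a b : α}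
    (hab : Relation.ReflTransGen r a b) : Relation.ReflTransGen q a b := by
  induction hab with
  | refl => exact Relation.ReflTransGen.refl
  | tail _ h2 ih => exact ih.tail (h _ _ h2)

/-- Reaching a final class. -/
lemma reach_final {n : ℕ} (EI : Finset (Fin n × Fin n)) (I : Finset (Fin n))
    (hEI : ∀ p ∈ EI, p.1 ∈ I ∧ p.2 ∈ I) (i : Fin n) (hi : i ∈ I) :
    ∃ G, FinalClass EI I G ∧ ∃ g ∈ G, Relation.ReflTransGen (fun a b => (a, b) ∈ EI) i g := by
  classical
  let R : Fin n → Finset (Fin n) := fun a =>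
    Finset.univ.filter (fun b => Relation.ReflTransGen (fun a b => (a, b) ∈ EI) a b)
  have mR : ∀ a b, b ∈ R a ↔ Relation.ReflTransGen (fun a b => (a, b) ∈ EI) a b := by
    intro a b; simp [R]
  obtain ⟨m, hm, hmin⟩ := Finset.exists_min_image (R i) (fun a => (R a).card)
    ⟨i, (mR i i).2 Relation.ReflTransGen.refl⟩
  have him := (mR i m).1 hm
  have hsub : ∀ a ∈ R m, R a = R m := by
    intro a ha
    apply Finset.eq_of_subset_of_card_le
    · intro b hb
      exact (mR _ _).2 (((mR _ _).1 ha).trans ((mR _ _).1 hb))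
    · exact hmin a ((mR _ _).2 (him.trans ((mR _ _).1 ha)))
  have hRI : ∀ b, Relation.ReflTransGen (fun a b => (a, b) ∈ EI) i b → b ∈ I := by
    intro b hb
    induction hb with
    | refl => exact hi
    | tail _ h _ => exact (hEI _ h).2
  refine ⟨R m, ⟨⟨m, (mR _ _).2 Relation.ReflTransGen.refl⟩, ?_, ?_, ?_⟩, m,
    (mR _ _).2 Relation.ReflTransGen.refl, him⟩
  · intro b hb
    exact hRI b (him.trans ((mR _ _).1 hb))
  · intro a ha b hb
    have hab := (mR a b).1 (by rw [hsub a ha]; exact hb)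
    clear hb
    induction hab with
    | refl => exact Relation.ReflTransGen.refl
    | tail h1 h2 ih =>
      have hx := ((mR m a).1 ha).trans h1
      exact ih.tail ⟨h2, (mR _ _).2 hx, (mR _ _).2 (hx.tail h2)⟩
  · intro p hp h
    exact (mR _ _).2 (((mR _ _).1 h).tail hp)

lemma final_closed {n : ℕ} {EI : Finset (Fin n × Fin n)} {I G : Finset (Fin n)}
    (hG : FinalClass EI I G) {a b : Fin n} (ha : a ∈ G)
    (h : Relation.ReflTransGen (fun a b => (a, b) ∈ EI) a b) : b ∈ G := by
  induction h with
  | refl => exact ha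
  | tail _ h ih => exact hG.2.2.2 _ h ih

lemma final_path {n : ℕ} {EI : Finset (Fin n × Fin n)} {I G : Finset (Fin n)}
    (hG : FinalClass EI I G) {a b : Fin n} (ha : a ∈ G) (hb : b ∈ G) :
    Relation.ReflTransGen (fun a b => (a, b) ∈ EI) a b :=
  rtg_mono (fun _ _ h => h.1) (hG.2.2.1 a ha b hb)

lemma final_subset {n : ℕ} {EI : Finset (Fin n × Fin n)} {I G H : Finset (Fin n)}
    (hG : FinalClass EI I G) (hH : FinalClass EI I H) {i : Fin n} (hi : i ∈ G) (hi' : i ∈ H) :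
    G ⊆ H := fun _ hk => final_closed hH hi' (final_path hG hi hk)

/-- Singleton without outlinks is a final class. -/
lemma final_singleton {n : ℕ} {EI : Finset (Fin n × Fin n)} {I : Finset (Fin n)} {i : Fin n}
    (hi : i ∈ I) (h : nb EI i = ∅) : FinalClass EI I {i} := by
  refine ⟨⟨i, by simp⟩, by simpa using hi, ?_, ?_⟩
  · intro a ha b hb
    rw [Finset.mem_singleton] at ha hb
    subst ha; subst hb; exact Relation.ReflTransGen.refl
  · rintro ⟨a, b⟩ hp ha
    simp only [Finset.mem_singleton] at ha
    subst ha
    have : b ∈ nb EI a := (mem_nb _ _ _).2 hp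
    simp [h] at this

lemma final_of_empty {n : ℕ} {EI : Finset (Fin n × Fin n)} {I G : Finset (Fin n)} {i k : Fin n}
    (hG : FinalClass EI I G) (hi : i ∈ G) (hk : k ∈ G) (h : nb EI i = ∅) : k = i := by
  rcases Relation.ReflTransGen.cases_head (final_path hG hi hk) with h1 | ⟨b, hb, -⟩
  · exact h1.symm
  · have : b ∈ nb EI i := (mem_nb _ _ _).2 hb
    simp [h] at this

lemma nb_in {n : ℕ} {I : Finset (Fin n)} {EI Ein Eext : Finset (Fin n × Fin n)}
    (hEin : ∀ p ∈ Ein, p.1 ∉ I ∧ p.2 ∈ I) (hEext : ∀ p ∈ Eext, p.1 ∉ I ∧ p.2 ∉ I)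
    (F : Finset (Fin n × Fin n)) {i : Fin n} (hi : i ∈ I) :
    nb (EI ∪ F ∪ Ein ∪ Eext) i = nb EI i ∪ nb F i := by
  ext j
  simp only [mem_nb, Finset.mem_union]
  constructor
  · rintro ((h | h) | h)
    · exact h
    · exact absurd hi (hEin _ h).1
    · exact absurd hi (hEext _ h).1
  · intro h; exact Or.inl (Or.inl h)

lemma nb_out {n : ℕ} {I : Finset (Fin n)} {EI Ein Eext F F' : Finset (Fin n × Fin n)}
    (hF : ∀ p ∈ F, p.1 ∈ I ∧ p.2 ∉ I) (hF' : ∀ p ∈ F', p.1 ∈ I ∧ p.2 ∉ I)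
    {i : Fin n} (hi : i ∉ I) :
    nb (EI ∪ F ∪ Ein ∪ Eext) i = nb (EI ∪ F' ∪ Ein ∪ Eext) i := by
  ext j
  simp only [mem_nb, Finset.mem_union]
  have h1 : (i, j) ∉ F := fun h => hi (hF _ h).1
  have h2 : (i, j) ∉ F' := fun h => hi (hF' _ h).1
  simp [h1, h2]

/-- Admissibility from hitting all final classes. -/
lemma adm_of_hit {n : ℕ} {I : Finset (Fin n)} {EI Ein Eext F F' : Finset (Fin n × Fin n)}
    (hEI : ∀ p ∈ EI, p.1 ∈ I ∧ p.2 ∈ I)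
    (hF : ∀ p ∈ F, p.1 ∈ I ∧ p.2 ∉ I) (hF' : ∀ p ∈ F', p.1 ∈ I ∧ p.2 ∉ I)
    (hAdm : admissible (EI ∪ F ∪ Ein ∪ Eext) I)
    (hit : ∀ G, FinalClass EI I G → ∃ p ∈ F', p.1 ∈ G) :
    admissible (EI ∪ F' ∪ Ein ∪ Eext) I := by
  refine ⟨?_, ?_⟩
  · intro i
    by_cases hi : i ∈ I
    · apply Finset.card_pos.2
      rcases Finset.eq_empty_or_nonempty (nb EI i) with h | ⟨j, hj⟩
      · obtain ⟨⟨a, b⟩, hp, ha⟩ := hit _ (final_singleton hi h)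
        simp only [Finset.mem_singleton] at ha
        subst ha
        exact ⟨b, by simp [hp]⟩
      · rw [mem_nb] at hj
        exact ⟨j, by simp [hj]⟩
    · have h := hAdm.1 i
      have h2 := nb_out (EI := EI) (Ein := Ein) (Eext := Eext) hF hF' hi
      unfold outdeg at h ⊢
      unfold nb at h2
      rwa [← h2]
  · intro i hi
    obtain ⟨G, hG, g, hg, hig⟩ := reach_final EI I hEI i hi
    obtain ⟨⟨a, b⟩, hp, ha⟩ := hit G hG
    refine ⟨b, by simpa using (hF' _ hp).2, ?_⟩
    have h1 := hig.trans (final_path hG hg ha)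
    have h2 : Relation.ReflTransGen (fun a b => (a, b) ∈ EI ∪ F' ∪ Ein ∪ Eext) i a :=
      rtg_mono (fun a b (h : (a, b) ∈ EI) => by simp [h]) h1
    exact h2.tail (by simp [hp])

lemma hit_of_adm {n : ℕ} {I : Finset (Fin n)} {EI Ein Eext F : Finset (Fin n × Fin n)}
    (hEin : ∀ p ∈ Ein, p.1 ∉ I ∧ p.2 ∈ I)
    (hEext : ∀ p ∈ Eext, p.1 ∉ I ∧ p.2 ∉ I)
    (hAdm : admissible (EI ∪ F ∪ Ein ∪ Eext) I) (G : Finset (Fin n))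
    (hG : FinalClass EI I G) : ∃ p ∈ F, p.1 ∈ G := by
  by_contra hcon
  push Not at hcon
  obtain ⟨g, hg⟩ := hG.1
  obtain ⟨j, hj, hpath⟩ := hAdm.2 g (hG.2.1 hg)
  have : j ∈ G := by
    clear hj
    induction hpath with
    | refl => exact hg
    | tail _ h ih =>
      simp only [Finset.mem_union] at h
      rcases h with ((h | h) | h) | h
      · exact hG.2.2.2 _ h ih
      · exact absurd ih (hcon _ h)
      · exact absurd (hG.2.1 ih) (hEin _ h).1
      · exact absurd (hG.2.1 ih) (hEext _ h).1
  exact (Finset.mem_compl.1 hj) (hG.2.1 this)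

/-- The local optimality inequality: change the outlinks of a single node `i`. -/
lemma local_opt {n : ℕ} (c : ℝ) (hc0 : 0 < c) (hc1 : c < 1)
    (z : Fin n → ℝ) (hz : ∀ i, 0 < z i)
    (I : Finset (Fin n))
    (EI Ein Eext : Finset (Fin n × Fin n))
    (hEI : ∀ p ∈ EI, p.1 ∈ I ∧ p.2 ∈ I)
    (hEin : ∀ p ∈ Ein, p.1 ∉ I ∧ p.2 ∈ I)
    (hEext : ∀ p ∈ Eext, p.1 ∉ I ∧ p.2 ∉ I)
    (F : Finset (Fin n × Fin n)) (hF : ∀ p ∈ F, p.1 ∈ I ∧ p.2 ∉ I)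
    (hAdm : admissible (EI ∪ F ∪ Ein ∪ Eext) I)
    (hOpt : ∀ F' : Finset (Fin n × Fin n), (∀ p ∈ F', p.1 ∈ I ∧ p.2 ∉ I) →
      admissible (EI ∪ F' ∪ Ein ∪ Eext) I →
      prSet c z (EI ∪ F' ∪ Ein ∪ Eext) I ≤ prSet c z (EI ∪ F ∪ Ein ∪ Eext) I)
    (v : Fin n → ℝ) (hv : v = vvec c (EI ∪ F ∪ Ein ∪ Eext) I)
    (i : Fin n) (hi : i ∈ I) (T : Finset (Fin n)) (hT : ∀ j ∈ T, j ∉ I)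
    (hcond : T.Nonempty ∨ ∀ G, FinalClass EI I G → ∃ p ∈ F, p.1 ∈ G ∧ p.1 ≠ i) :
    ∑ j ∈ nb EI i, v j + ∑ j ∈ T, v j ≤
      (Pmat (EI ∪ F ∪ Ein ∪ Eext) *ᵥ v) i * ((nb EI i).card + T.card) := by
  classical
  set F' : Finset (Fin n × Fin n) :=
    F.filter (fun p => p.1 ≠ i) ∪ T.image (fun j => (i, j)) with hF'def
  have mF' : ∀ a b, (a, b) ∈ F' ↔ ((a, b) ∈ F ∧ a ≠ i) ∨ (a = i ∧ b ∈ T) := by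
    intro a b
    simp only [hF'def, Finset.mem_union, Finset.mem_filter, Finset.mem_image, Prod.mk.injEq]
    constructor
    · rintro (h | ⟨x, hx, h1, h2⟩)
      · exact Or.inl h
      · subst h1; subst h2; exact Or.inr ⟨rfl, hx⟩
    · rintro (h | ⟨h1, h2⟩)
      · exact Or.inl h
      · exact Or.inr ⟨b, h2, h1.symm, rfl⟩
  have hF' : ∀ p ∈ F', p.1 ∈ I ∧ p.2 ∉ I := by
    rintro ⟨a, b⟩ hp
    rcases (mF' a b).1 hp with ⟨h, _⟩ | ⟨h1, h2⟩
    · exact hF _ h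
    · subst h1; exact ⟨hi, hT _ h2⟩
  have hit : ∀ G, FinalClass EI I G → ∃ p ∈ F', p.1 ∈ G := by
    intro G hG
    rcases hcond with ⟨t, ht⟩ | h
    · obtain ⟨⟨a, b⟩, hp, ha⟩ := hit_of_adm hEin hEext hAdm G hG
      by_cases hai : a = i
      · subst hai
        exact ⟨(a, t), (mF' _ _).2 (Or.inr ⟨rfl, ht⟩), ha⟩
      · exact ⟨(a, b), (mF' _ _).2 (Or.inl ⟨hp, hai⟩), ha⟩
    · obtain ⟨⟨a, b⟩, hp, ha, hne⟩ := h G hG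
      exact ⟨(a, b), (mF' _ _).2 (Or.inl ⟨hp, hne⟩), ha⟩
  have hAdm' := adm_of_hit (Ein := Ein) (Eext := Eext) hEI hF hF' hAdm hit
  have hpr := hOpt F' hF' hAdm'
  have hnb : nb (EI ∪ F' ∪ Ein ∪ Eext) i = nb EI i ∪ T := by
    rw [nb_in hEin hEext F' hi]
    congr 1
    ext j
    simp [mem_nb, mF']
  have hdis : Disjoint (nb EI i) T := by
    rw [Finset.disjoint_left]
    intro a ha hb
    exact hT a hb (hEI _ ((mem_nb _ _ _).1 ha)).2
  have hne : ∀ a, a ≠ i → nb (EI ∪ F' ∪ Ein ∪ Eext) a = nb (EI ∪ F ∪ Ein ∪ Eext) a := by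
    intro a ha
    ext b
    simp [mem_nb, mF', ha]
  by_contra hcon
  push Not at hcon
  have hE' := Pmat_mulVec' (EI ∪ F' ∪ Ein ∪ Eext) hAdm'.1 v i
  have hpos : (0 : ℝ) < ((nb (EI ∪ F' ∪ Ein ∪ Eext) i).card : ℝ) := by
    have h2 : 0 < (nb (EI ∪ F' ∪ Ein ∪ Eext) i).card := hAdm'.1 i
    exact_mod_cast h2
  rw [hnb] at hE' hpos
  rw [Finset.sum_union hdis, Finset.card_union_of_disjoint hdis, Nat.cast_add] at hE'
  rw [Finset.card_union_of_disjoint hdis, Nat.cast_add] at hpos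
  rw [← hE'] at hcon
  have hlt := lt_of_mul_lt_mul_right hcon hpos.le
  subst hv
  have := compare_pr c hc0 hc1 z hz _ _ hAdm.1 hAdm'.1 I (by
    intro a
    by_cases ha : a = i
    · subst ha; exact hlt.le
    · rw [Pmat_mulVec, Pmat_mulVec, hne a ha]) hpr i
  linarith

/-- Theorem 10 (Optimal outlink structure): with `E_I`, `E_in(I)`, `E_Ī` fixed and
`F₁,…,F_r` the final classes of `(I, E_I)`, every optimal outlink set `F` satisfies:
every link of `F` starts in some final class; links starting in `F_s` start at a node
minimizing `v` on `F_s` and end in `V = argmax_{j ∉ I} v j`; and if `E_I` has a link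
inside `F_s` then `F_s` sends exactly one outlink. -/
theorem stmt11 {n : ℕ} (hn : 1 ≤ n) (c : ℝ) (hc0 : 0 < c) (hc1 : c < 1)
    (z : Fin n → ℝ) (hz : ∀ i, 0 < z i) (hz1 : ∑ i, z i = 1)
    (I : Finset (Fin n)) (hI : I.Nonempty) (hIc : (Iᶜ : Finset (Fin n)).Nonempty)
    (EI Ein Eext : Finset (Fin n × Fin n))
    (hEI : ∀ p ∈ EI, p.1 ∈ I ∧ p.2 ∈ I)
    (hEin : ∀ p ∈ Ein, p.1 ∉ I ∧ p.2 ∈ I)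
    (hEext : ∀ p ∈ Eext, p.1 ∉ I ∧ p.2 ∉ I)
    (r : ℕ) (Fc : Fin r → Finset (Fin n)) (hFcInj : Function.Injective Fc)
    (hFc : ∀ Fs : Finset (Fin n), FinalClass EI I Fs ↔ ∃ s : Fin r, Fc s = Fs)
    (F : Finset (Fin n × Fin n)) (hF : ∀ p ∈ F, p.1 ∈ I ∧ p.2 ∉ I)
    (hAdm : admissible (EI ∪ F ∪ Ein ∪ Eext) I)
    (hOpt : ∀ F' : Finset (Fin n × Fin n), (∀ p ∈ F', p.1 ∈ I ∧ p.2 ∉ I) →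
      admissible (EI ∪ F' ∪ Ein ∪ Eext) I →
      prSet c z (EI ∪ F' ∪ Ein ∪ Eext) I ≤ prSet c z (EI ∪ F ∪ Ein ∪ Eext) I) :
    (∀ p ∈ F, ∃ s : Fin r, p.1 ∈ Fc s) ∧
    (∀ s : Fin r, ∀ p ∈ F, p.1 ∈ Fc s →
      (∀ k ∈ Fc s, vvec c (EI ∪ F ∪ Ein ∪ Eext) I p.1 ≤
        vvec c (EI ∪ F ∪ Ein ∪ Eext) I k) ∧
      p.2 ∉ I ∧
      (∀ k, k ∉ I → vvec c (EI ∪ F ∪ Ein ∪ Eext) I k ≤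
        vvec c (EI ∪ F ∪ Ein ∪ Eext) I p.2)) ∧
    (∀ s : Fin r, (EI ∩ (Fc s ×ˢ Fc s)).Nonempty →
      (F.filter (fun p => p.1 ∈ Fc s)).card = 1) := by
  classical
  have hloc := local_opt c hc0 hc1 z hz I EI Ein Eext hEI hEin hEext F hF hAdm hOpt _ rfl
  have hveq := vvec_eq c hc0 hc1 _ hAdm.1 I
  have hPc := Pmat_mulVec' _ hAdm.1 (vvec c (EI ∪ F ∪ Ein ∪ Eext) I)
  set E := EI ∪ F ∪ Ein ∪ Eext with hEdef
  set v := vvec c E I with hvdef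
  set a : Fin n → ℝ := Pmat E *ᵥ v with ha
  have h1c : 0 < 1 - c := by linarith
  -- upper bounds
  have hub : ∀ i, v i ≤ 1 / (1 - c) := by
    intro i
    obtain ⟨m, -, hm⟩ := Finset.exists_max_image (Finset.univ : Finset (Fin n)) v ⟨i, Finset.mem_univ _⟩
    refine le_trans (hm i (Finset.mem_univ _)) ?_
    have hp : (0 : ℝ) < ((nb E m).card : ℝ) := by
      have h2 : 0 < (nb E m).card := hAdm.1 m
      exact_mod_cast h2
    have h4 : ∑ j ∈ nb E m, v j ≤ ((nb E m).card : ℝ) * v m := by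
      have := Finset.sum_le_card_nsmul (nb E m) v (v m) (fun j _ => hm j (Finset.mem_univ _))
      simpa using this
    have h5 : a m ≤ v m := by
      have := hPc m
      by_contra hcon
      push Not at hcon
      nlinarith
    have h6 : ind I m ≤ 1 := by unfold ind; split_ifs <;> norm_num
    have h7 := hveq m
    rw [le_div_iff₀ h1c]
    nlinarith
  have haub : ∀ i, a i ≤ 1 / (1 - c) := by
    intro i
    have hp : (0 : ℝ) < ((nb E i).card : ℝ) := by
      have h2 : 0 < (nb E i).card := hAdm.1 i
      exact_mod_cast h2
    have h4 : ∑ j ∈ nb E i, v j ≤ ((nb E i).card : ℝ) * (1 / (1 - c)) := by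
      have := Finset.sum_le_card_nsmul (nb E i) v (1 / (1 - c)) (fun j _ => hub j)
      simpa using this
    have := hPc i
    by_contra hcon
    push Not at hcon
    nlinarith
  set B := 1 / (1 - c) with hB
  have hB1 : B = 1 + c * B := by rw [hB]; field_simp; ring
  have hBpos : 0 < B := by rw [hB]; positivity
  have hvI : ∀ i ∈ I, v i = 1 + c * a i := by
    intro i hi
    rw [hveq i]; simp [ind, hi]
  have hvO : ∀ i, i ∉ I → v i < B := by
    intro i hi
    have := hveq i
    simp only [ind, hi, if_false] at this
    have h2 := haub i
    nlinarith
  obtain ⟨js, hjs, hjmax⟩ := Finset.exists_max_image (Iᶜ) v hIc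
  rw [Finset.mem_compl] at hjs
  have hjmax' : ∀ k, k ∉ I → v k ≤ v js := fun k hk => hjmax k (Finset.mem_compl.2 hk)
  have hMB := hvO js hjs
  set M := v js with hM
  -- data for nodes in I
  have hsum : ∀ i ∈ I, ∑ j ∈ nb EI i, v j + ∑ j ∈ nb F i, v j =
      a i * ((nb EI i).card + (nb F i).card) := by
    intro i hi
    have h := hPc i
    have hdis : Disjoint (nb EI i) (nb F i) := by
      rw [Finset.disjoint_left]
      intro x hx hy
      exact (hF _ ((mem_nb _ _ _).1 hy)).2 (hEI _ ((mem_nb _ _ _).1 hx)).2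
    rw [hEdef, nb_in hEin hEext F hi, Finset.sum_union hdis, Finset.card_union_of_disjoint hdis,
      Nat.cast_add] at h
    exact h.symm
  have hone : ∀ i ∈ I, ∑ j ∈ nb EI i, v j + M ≤ a i * ((nb EI i).card + 1) := by
    intro i hi
    have := hloc i hi {js} (by simpa using hjs) (Or.inl ⟨js, by simp⟩)
    simpa using this
  have hlow : ∀ (i : Fin n) (x : ℝ), (∀ j ∈ nb EI i, x ≤ v j) →
      ((nb EI i).card : ℝ) * x ≤ ∑ j ∈ nb EI i, v j := by
    intro i x h
    have := Finset.card_nsmul_le_sum (nb EI i) v x h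
    simpa using this
  have nbI : ∀ i j, j ∈ nb EI i → j ∈ I := fun i j h => (hEI _ ((mem_nb _ _ _).1 h)).2
  -- step 1
  have hgt : ∀ i ∈ I, M < v i := by
    obtain ⟨m, hm, hmin⟩ := Finset.exists_min_image I v hI
    intro i hi
    refine lt_of_lt_of_le ?_ (hmin i hi)
    by_contra hcon
    push Not at hcon
    have h1 := hvI m hm
    have h2 : a m < v m := by
      by_contra h
      push Not at h
      nlinarith
    have h3 := hone m hm
    have h4 := hlow m (v m) (fun j hj => hmin j (nbI m j hj))
    have h5 : (0 : ℝ) ≤ ((nb EI m).card : ℝ) := Nat.cast_nonneg _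
    nlinarith
  have hcard1 : ∀ i, (nb EI i).Nonempty → (1 : ℝ) ≤ ((nb EI i).card : ℝ) := by
    intro i h
    exact_mod_cast Finset.card_pos.2 h
  -- step 2
  have haM : ∀ i ∈ I, M ≤ a i := by
    intro i hi
    have h3 := hone i hi
    have h4 := hlow i M (fun j hj => (hgt j (nbI i j hj)).le)
    have h5 : (0 : ℝ) ≤ ((nb EI i).card : ℝ) := Nat.cast_nonneg _
    by_contra hcon
    push Not at hcon
    nlinarith
  have hSgt : ∀ i, (nb EI i).Nonempty → ((nb EI i).card : ℝ) * M < ∑ j ∈ nb EI i, v j := by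
    intro i h
    have := Finset.sum_lt_sum_of_nonempty (f := fun _ => M) (g := v) h
      (fun j hj => hgt j (nbI i j hj))
    simpa using this
  have haM' : ∀ i ∈ I, (nb EI i).Nonempty → M < a i := by
    intro i hi hne
    have h3 := hone i hi
    have h4 := hSgt i hne
    have h5 := hcard1 i hne
    by_contra hcon
    push Not at hcon
    nlinarith
  have hKle : ∀ i, ∑ j ∈ nb F i, v j ≤ ((nb F i).card : ℝ) * M := by
    intro i
    have := Finset.sum_le_card_nsmul (nb F i) v M
      (fun j hj => hjmax' j (hF _ ((mem_nb _ _ _).1 hj)).2)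
    simpa using this
  have hKV : ∀ i ∈ I, ∀ j ∈ nb F i, v j = M := by
    intro i hi j hj
    have hk : (1 : ℝ) ≤ ((nb F i).card : ℝ) := by
      exact_mod_cast Finset.card_pos.2 ⟨j, hj⟩
    have h1 := hsum i hi
    have h2 := hone i hi
    have h3 := haM i hi
    have h4 : ((nb F i).card : ℝ) * M ≤ ∑ j ∈ nb F i, v j := by nlinarith
    have hjle : ∀ x ∈ nb F i, v x ≤ M := fun x hx => hjmax' x (hF _ ((mem_nb _ _ _).1 hx)).2
    by_contra hne
    have hlt := Finset.sum_lt_sum (f := v) (g := fun _ => M) hjle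
      ⟨j, hj, lt_of_le_of_ne (hjle j hj) hne⟩
    simp only [Finset.sum_const, nsmul_eq_mul] at hlt
    linarith
  have hK1 : ∀ i ∈ I, (nb EI i).Nonempty → (nb F i).card ≤ 1 := by
    intro i hi hne
    by_contra hcon
    push Not at hcon
    have hk : (2 : ℝ) ≤ ((nb F i).card : ℝ) := by exact_mod_cast hcon
    have h1 := hsum i hi
    have h2 := hone i hi
    have h3 := haM' i hi hne
    have h4 := hKle i
    nlinarith
  -- step 3
  have hfin : ∀ p ∈ F, (nb EI p.1).Nonempty →
      ∃ G, FinalClass EI I G ∧ p.1 ∈ G ∧ ∀ q ∈ F, q.1 ∈ G → q = p := by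
    rintro ⟨i, j⟩ hp hne
    have hi := (hF _ hp).1
    simp only at hi hne
    have hjK : j ∈ nb F i := (mem_nb _ _ _).2 hp
    have hc1' : (nb F i).card = 1 := le_antisymm (hK1 i hi hne) (Finset.card_pos.2 ⟨j, hjK⟩)
    have hex : ∃ G, FinalClass EI I G ∧ ∀ q ∈ F, q.1 ∈ G → q.1 = i := by
      by_contra hcon
      push Not at hcon
      have h1 := hloc i hi ∅ (by simp) (Or.inr hcon)
      have h2 := hone i hi
      have h3 := haM' i hi hne
      have h4 := hsum i hi
      have h5 := hKle i
      rw [hc1'] at h4 h5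
      simp only [Finset.sum_empty, Finset.card_empty, Nat.cast_zero, add_zero, Nat.cast_one] at h1 h4 h5
      nlinarith
    obtain ⟨G, hG, hq⟩ := hex
    refine ⟨G, hG, ?_, ?_⟩
    · obtain ⟨q, hqF, hqG⟩ := hit_of_adm hEin hEext hAdm G hG
      have := hq q hqF hqG
      rw [← this]; exact hqG
    · rintro ⟨x, y⟩ hqF hqG
      have hx : x = i := hq _ hqF hqG
      subst hx
      have hy : y ∈ nb F x := (mem_nb _ _ _).2 hqF
      have := Finset.card_le_one.1 hc1'.le y hy j hjK
      rw [this]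
  have hFcl : ∀ s, FinalClass EI I (Fc s) := fun s => (hFc _).2 ⟨s, rfl⟩
  have huniq : ∀ s, ∀ p ∈ F, p.1 ∈ Fc s → (nb EI p.1).Nonempty →
      ∀ q ∈ F, q.1 ∈ Fc s → q = p := by
    intro s p hp hps hne q hq hqs
    obtain ⟨G, hG, hpG, h⟩ := hfin p hp hne
    exact h q hq (final_subset (hFcl s) hG hps hpG hqs)
  refine ⟨?_, ?_, ?_⟩
  · intro p hp
    rcases Finset.eq_empty_or_nonempty (nb EI p.1) with h | h
    · obtain ⟨s, hs⟩ := (hFc _).1 (final_singleton (hF p hp).1 h)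
      exact ⟨s, by rw [hs]; simp⟩
    · obtain ⟨G, hG, hpG, -⟩ := hfin p hp h
      obtain ⟨s, hs⟩ := (hFc _).1 hG
      exact ⟨s, by rw [hs]; exact hpG⟩
  · intro s p hp hps
    refine ⟨?_, (hF p hp).2, ?_⟩
    · rcases Finset.eq_empty_or_nonempty (nb EI p.1) with h | h
      · intro k hk
        rw [final_of_empty (hFcl s) hps hk h]
      · obtain ⟨m, hm, hmin⟩ := Finset.exists_min_image (Fc s) v ⟨p.1, hps⟩
        have hmI := (hFcl s).2.1 hm
        have hpI := (hF p hp).1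
        by_cases hmp : m = p.1
        · rw [← hmp]; exact hmin
        · exfalso
          have hempty : nb F m = ∅ := by
            rw [Finset.eq_empty_iff_forall_notMem]
            intro y hy
            have := huniq s p hp hps h (m, y) ((mem_nb _ _ _).1 hy) hm
            exact hmp (by rw [← this])
          have hmne : (nb EI m).Nonempty := by
            rw [Finset.nonempty_iff_ne_empty]
            intro he
            exact hmp (final_of_empty (hFcl s) hm hps he).symm
          have h1 := hsum m hmI
          rw [hempty] at h1
          simp only [Finset.sum_empty, Finset.card_empty, Nat.cast_zero, add_zero] at h1
          have h2 := hlow m (v m) (fun j hj =>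
            hmin j ((hFcl s).2.2.2 _ ((mem_nb _ _ _).1 hj) hm))
          have h3 := hcard1 m hmne
          have h4 : v m ≤ a m := by
            by_contra hcon
            push Not at hcon
            nlinarith
          have h5 := hvI m hmI
          have h6 : B ≤ v m := by nlinarith
          have h7 := hmin p.1 hps
          -- contradiction at p.1
          have h8 := hsum p.1 hpI
          have h9 := hKle p.1
          have h10 : (1 : ℝ) ≤ ((nb F p.1).card : ℝ) := by
            exact_mod_cast Finset.card_pos.2 ⟨p.2, (mem_nb _ _ _).2 hp⟩
          have h11 : ∑ j ∈ nb EI p.1, v j ≤ ((nb EI p.1).card : ℝ) * B := by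
            have := Finset.sum_le_card_nsmul (nb EI p.1) v B (fun j _ => hub j)
            simpa using this
          have h12 := hvI p.1 hpI
          have h13 : B ≤ a p.1 := by nlinarith
          have h14 := hcard1 p.1 h
          nlinarith
    · have := hKV p.1 (hF p hp).1 p.2 ((mem_nb _ _ _).2 hp)
      rw [this]; exact hjmax'
  · rintro s ⟨⟨x, y⟩, hxy⟩
    simp only [Finset.mem_inter, Finset.mem_product] at hxy
    obtain ⟨hxyE, hx, hy⟩ := hxy
    obtain ⟨p, hp, hps⟩ := hit_of_adm hEin hEext hAdm _ (hFcl s)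
    have hne : (nb EI p.1).Nonempty := by
      rw [Finset.nonempty_iff_ne_empty]
      intro he
      have hxp := final_of_empty (hFcl s) hps hx he
      subst hxp
      have : y ∈ nb EI p.1 := (mem_nb _ _ _).2 hxyE
      simp [he] at this
    rw [Finset.card_eq_one]
    refine ⟨p, ?_⟩
    ext q
    simp only [Finset.mem_filter, Finset.mem_singleton]
    constructor
    · rintro ⟨hq, hqs⟩
      exact huniq s p hp hps hne q hq hqs
    · rintro rfl
      exact ⟨hp, hps⟩
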